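/- Opial's theorem: Let D be a nonempty closed convex subset of a real Hilbert space H and let h : D → D be an averaged operator with Fix(h) ≠ ∅. Then for any x⁰ ∈ D, the sequence defined by x^{k+1} = h(x^k) converges weakly to a point in Fix(h). -/

import Mathlib

open Filter Topology RealInnerProductSpace

section WeakConvergence

variable {H ι : Type*} [NormedAddCommGroup H] [InnerProductSpace ℝ H]

/-- Bounded families in a Hilbert space converge weakly along every ultrafilter. -/
theorem Ultrafilter.exists_tendsto_inner_of_norm_le [CompleteSpace H] (U : Ultrafilter ι)
    {x : ι → H} {R : ℝ} (hR : ∀ k, ‖x k‖ ≤ R) :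
    ∃ w : H, ∀ y : H, Tendsto (fun k => ⟪x k, y⟫) U (𝓝 ⟪w, y⟫) := by
  let g : ι → WeakDual ℝ H := fun k =>
    StrongDual.toWeakDual (InnerProductSpace.toDual ℝ H (x k))
  have hmem : ∀ k, g k ∈ WeakDual.toStrongDual ⁻¹' Metric.closedBall (0 : StrongDual ℝ H) R := by
    intro k
    simpa [g] using hR k
  obtain ⟨f, -, hf⟩ := (WeakDual.isCompact_closedBall (0 : StrongDual ℝ H) R).ultrafilter_le_nhds
    (U.map g) (le_principal_iff.2 (Filter.mem_map.2 (univ_mem' hmem)))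
  refine ⟨(InnerProductSpace.toDual ℝ H).symm (WeakDual.toStrongDual f), fun y => ?_⟩
  rw [InnerProductSpace.toDual_symm_apply]
  exact ((WeakDual.eval_continuous y).tendsto f).comp hf

/-- Closed convex subsets of a Hilbert space are weakly closed. -/
theorem IsClosed.mem_of_tendsto_inner [CompleteSpace H] {D : Set H} (hcl : IsClosed D)
    (hcv : Convex ℝ D) {l : Filter ι} [l.NeBot] {x : ι → H} (hx : ∀ k, x k ∈ D) {w : H}
    (hw : ∀ y : H, Tendsto (fun k => ⟪x k, y⟫) l (𝓝 ⟪w, y⟫)) : w ∈ D := by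
  obtain ⟨k₀⟩ := l.nonempty_of_neBot
  obtain ⟨p, hp, hpw⟩ := exists_norm_eq_iInf_of_complete_convex ⟨x k₀, hx k₀⟩ hcl.isComplete hcv w
  have hle := (norm_eq_iInf_iff_real_inner_le_zero hcv hp).1 hpw
  have hlim : ⟪w, w - p⟫ ≤ ⟪p, w - p⟫ := le_of_tendsto' (hw (w - p)) fun k => by
    have := hle (x k) (hx k)
    rw [real_inner_comm, inner_sub_left] at this
    linarith
  have h0 : ⟪w - p, w - p⟫ ≤ 0 := by
    rw [inner_sub_left]
    linarith
  rw [real_inner_self_nonpos, sub_eq_zero] at h0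
  rwa [h0]

/-- Demiclosedness principle: a weak limit of almost fixed points of a nonexpansive map is a
fixed point. -/
theorem fixed_of_tendsto_inner_of_tendsto_norm_sub {D : Set H} {N : H → H}
    (hN : ∀ x ∈ D, ∀ y ∈ D, ‖N x - N y‖ ≤ ‖x - y‖) {l : Filter ι} [l.NeBot] {x : ι → H}
    (hx : ∀ k, x k ∈ D) {R : ℝ} (hR : ∀ k, ‖x k‖ ≤ R) {w : H} (hwD : w ∈ D)
    (hw : ∀ y : H, Tendsto (fun k => ⟪x k, y⟫) l (𝓝 ⟪w, y⟫))
    (hreg : Tendsto (fun k => ‖x k - N (x k)‖) l (𝓝 0)) : N w = w := by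
  have hbound : ∀ k, ‖w - N w‖ ^ 2 ≤ 2 * (R + ‖w‖) * ‖x k - N (x k)‖ + ‖x k - N (x k)‖ ^ 2
      - 2 * (⟪x k, w - N w⟫ - ⟪w, w - N w⟫) := by
    intro k
    have htri : ‖x k - N w‖ ≤ ‖x k - N (x k)‖ + ‖x k - w‖ :=
      (norm_sub_le_norm_sub_add_norm_sub _ (N (x k)) _).trans
        (add_le_add_right (hN _ (hx k) _ hwD) _)
    have hxw : ‖x k - w‖ ≤ R + ‖w‖ := (norm_sub_le _ _).trans (add_le_add_left (hR k) _)
    have hexp : ‖x k - N w‖ ^ 2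
        = ‖x k - w‖ ^ 2 + 2 * (⟪x k, w - N w⟫ - ⟪w, w - N w⟫) + ‖w - N w‖ ^ 2 := by
      rw [← inner_sub_left, ← norm_add_sq_real, sub_add_sub_cancel]
    have hsq := pow_le_pow_left₀ (norm_nonneg _) htri 2
    have hmul := mul_le_mul_of_nonneg_right hxw (norm_nonneg (x k - N (x k)))
    nlinarith
  have hlim := ((hreg.const_mul (2 * (R + ‖w‖))).add (hreg.pow 2)).sub
    (((hw (w - N w)).sub_const ⟪w, w - N w⟫).const_mul 2)
  have h0 := ge_of_tendsto' hlim hbound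
  have : ‖w - N w‖ = 0 := by
    simp only [sub_self, mul_zero, zero_pow two_ne_zero, add_zero] at h0
    exact pow_eq_zero_iff two_ne_zero |>.1 (le_antisymm h0 (sq_nonneg _))
  exact (sub_eq_zero.1 (norm_eq_zero.1 this)).symm

theorem norm_sq_convex_combination (c : ℝ) (a b : H) :
    ‖(1 - c) • a + c • b‖ ^ 2
      = (1 - c) * ‖a‖ ^ 2 + c * ‖b‖ ^ 2 - c * (1 - c) * ‖a - b‖ ^ 2 := by
  rw [norm_add_sq_real, norm_sub_sq_real, norm_smul, norm_smul, real_inner_smul_left,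
    real_inner_smul_right, mul_pow, mul_pow, Real.norm_eq_abs, Real.norm_eq_abs, sq_abs, sq_abs]
  ring

/-- Weak cluster points agree when the distances to both of them converge. -/
theorem eq_of_tendsto_inner_of_tendsto_norm_sub {l l₁ l₂ : Filter ι} [l₁.NeBot] [l₂.NeBot]
    (h₁ : l₁ ≤ l) (h₂ : l₂ ≤ l) {x : ι → H} {v w : H} {a b : ℝ}
    (hv : Tendsto (fun k => ⟪x k, v - w⟫) l₁ (𝓝 ⟪v, v - w⟫))
    (hw : Tendsto (fun k => ⟪x k, v - w⟫) l₂ (𝓝 ⟪w, v - w⟫))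
    (ha : Tendsto (fun k => ‖x k - v‖ ^ 2) l (𝓝 a))
    (hb : Tendsto (fun k => ‖x k - w‖ ^ 2) l (𝓝 b)) : v = w := by
  have hlim : Tendsto (fun k => ⟪x k, v - w⟫) l
      (𝓝 ((b - a + (‖v‖ ^ 2 - ‖w‖ ^ 2)) / 2)) := by
    refine (((hb.sub ha).add_const _).div_const 2).congr fun k => ?_
    rw [norm_sub_sq_real, norm_sub_sq_real, inner_sub_right]
    ring
  have h := (tendsto_nhds_unique hv (hlim.mono_left h₁)).trans
    (tendsto_nhds_unique hw (hlim.mono_left h₂)).symm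
  rw [← sub_eq_zero, ← inner_sub_left, inner_self_eq_zero, sub_eq_zero] at h
  exact h

end WeakConvergence

/-- Opial's theorem: if `h : D → D` is an averaged operator on a nonempty closed convex
subset `D` of a real Hilbert space with a fixed point, then the Picard iterates of `h`
from any starting point in `D` converge weakly to a fixed point of `h`. -/
theorem opial_weak_convergence
    {H : Type*} [NormedAddCommGroup H] [InnerProductSpace ℝ H] [CompleteSpace H]
    (D : Set H) (hne : D.Nonempty) (hcl : IsClosed D) (hcv : Convex ℝ D)
    (h : H → H) (hmaps : Set.MapsTo h D D)
    (hav : ∃ c ∈ Set.Ioo (0 : ℝ) 1, ∃ N : H → H, Set.MapsTo N D D ∧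
      (∀ x ∈ D, ∀ y ∈ D, ‖N x - N y‖ ≤ ‖x - y‖) ∧
      ∀ x ∈ D, h x = (1 - c) • x + c • N x)
    (hfix : ∃ z ∈ D, h z = z)
    (x : ℕ → H) (hx0 : x 0 ∈ D) (hiter : ∀ k : ℕ, x (k + 1) = h (x k)) :
    ∃ xs ∈ D, h xs = xs ∧ ∀ y : H, Tendsto (fun k => ⟪x k, y⟫) atTop (𝓝 ⟪xs, y⟫) := by
  obtain ⟨c, ⟨hc0, hc1⟩, N, -, hN, hhN⟩ := hav
  have hxD : ∀ k, x k ∈ D := fun k => by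
    induction k with
    | zero => exact hx0
    | succ k ih => exact hiter k ▸ hmaps ih
  have hfixN : ∀ z ∈ D, h z = z ↔ N z = z := fun z hz => by
    have hsub : h z - z = c • (N z - z) := by
      rw [hhN z hz]
      module
    rw [← sub_eq_zero, hsub, smul_eq_zero_iff_right hc0.ne', sub_eq_zero]
  have hstep : ∀ z ∈ D, N z = z → ∀ k,
      ‖x (k + 1) - z‖ ^ 2 + c * (1 - c) * ‖x k - N (x k)‖ ^ 2 ≤ ‖x k - z‖ ^ 2 := by
    intro z hz hNz k
    have hcomb : x (k + 1) - z = (1 - c) • (x k - z) + c • (N (x k) - z) := by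
      rw [hiter, hhN _ (hxD k)]
      module
    have hle : ‖N (x k) - z‖ ≤ ‖x k - z‖ := by simpa only [hNz] using hN _ (hxD k) _ hz
    have hsq := mul_le_mul_of_nonneg_left (pow_le_pow_left₀ (norm_nonneg _) hle 2) hc0.le
    rw [hcomb, norm_sq_convex_combination, sub_sub_sub_cancel_right]
    linarith
  have hcc : 0 < c * (1 - c) := mul_pos hc0 (sub_pos.2 hc1)
  have hanti : ∀ z ∈ D, N z = z → Antitone fun k => ‖x k - z‖ ^ 2 := fun z hz hNz =>
    antitone_nat_of_succ_le fun k => by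
      have := hstep z hz hNz k
      have := mul_nonneg hcc.le (sq_nonneg ‖x k - N (x k)‖)
      linarith
  have hconv : ∀ z ∈ D, N z = z → ∃ a, Tendsto (fun k => ‖x k - z‖ ^ 2) atTop (𝓝 a) :=
    fun z hz hNz => ⟨_, tendsto_atTop_ciInf (hanti z hz hNz)
      ⟨0, Set.forall_mem_range.2 fun k => sq_nonneg _⟩⟩
  obtain ⟨z, hz, hhz⟩ := hfix
  have hNz := (hfixN z hz).1 hhz
  have hR : ∀ k, ‖x k‖ ≤ ‖x 0 - z‖ + ‖z‖ := fun k => by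
    have hk : ‖x k - z‖ ≤ ‖x 0 - z‖ :=
      (sq_le_sq₀ (norm_nonneg _) (norm_nonneg _)).1 (hanti z hz hNz (Nat.zero_le k))
    calc ‖x k‖ = ‖(x k - z) + z‖ := by rw [sub_add_cancel]
      _ ≤ ‖x k - z‖ + ‖z‖ := norm_add_le _ _
      _ ≤ ‖x 0 - z‖ + ‖z‖ := by gcongr
  have hreg : Tendsto (fun k => ‖x k - N (x k)‖) atTop (𝓝 0) := by
    obtain ⟨a, ha⟩ := hconv z hz hNz
    have hdiff := (ha.sub (ha.comp (tendsto_add_atTop_nat 1))).div_const (c * (1 - c))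
    rw [sub_self, zero_div] at hdiff
    have hsq : Tendsto (fun k => ‖x k - N (x k)‖ ^ 2) atTop (𝓝 0) :=
      squeeze_zero (fun k => sq_nonneg _) (fun k => by
        rw [le_div_iff₀ hcc]
        have := hstep z hz hNz k
        simp only [Function.comp_apply]
        linarith) hdiff
    simpa using hsq.sqrt
  have hcluster : ∀ U : Ultrafilter ℕ, (U : Filter ℕ) ≤ atTop → ∃ w ∈ D, N w = w ∧
      ∀ y : H, Tendsto (fun k => ⟪x k, y⟫) U (𝓝 ⟪w, y⟫) := by
    intro U hU
    obtain ⟨w, hw⟩ := U.exists_tendsto_inner_of_norm_le hR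
    have hwD := hcl.mem_of_tendsto_inner hcv hxD hw
    exact ⟨w, hwD, fixed_of_tendsto_inner_of_tendsto_norm_sub hN hxD hR hwD hw
      (hreg.mono_left hU), hw⟩
  obtain ⟨v, hvD, hNv, hv⟩ := hcluster (Ultrafilter.of atTop) (Ultrafilter.of_le _)
  refine ⟨v, hvD, (hfixN v hvD).2 hNv, fun y => ?_⟩
  rw [tendsto_iff_ultrafilter]
  intro U hU
  obtain ⟨w, hwD, hNw, hw⟩ := hcluster U hU
  obtain ⟨a, ha⟩ := hconv v hvD hNv
  obtain ⟨b, hb⟩ := hconv w hwD hNw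
  rw [eq_of_tendsto_inner_of_tendsto_norm_sub (Ultrafilter.of_le _) hU (hv _) (hw _) ha hb]
  exact hw y
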